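/- Let κ be a cardinal, let S ⊆ κ be subtle, and let ⟨S_α : α ∈ S⟩ be an S-list. Let A be the set of all α ∈ S such that there exists X ⊆ S ∩ α which is Π^1_n-indescribable in α for every n < ω and which is homogeneous for ⟨S_α : α ∈ S⟩. Then S ∖ A is not subtle. -/

import Mathlib

namespace LCI


/-- `κ` is (the initial ordinal of) a regular uncountable cardinal. -/
def RegUncountable (kappa : Ordinal.{0}) : Prop :=
  Ordinal.omega0 < kappa ∧ kappa.cof.ord = kappa

/-- `C` is a club (closed unbounded) subset of the ordinal `κ`. -/
def IsClubIn (C : Set Ordinal.{0}) (kappa : Ordinal.{0}) : Prop :=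
  C ⊆ Set.Iio kappa ∧
  (∀ alpha < kappa, ∃ beta ∈ C, alpha < beta) ∧
  ∀ beta < kappa, beta ≠ 0 →
    (∀ gamma < beta, ∃ delta ∈ C, gamma < delta ∧ delta < beta) → beta ∈ C

/-- `S` is a stationary subset of the ordinal `κ`. -/
def IsStationaryIn (S : Set Ordinal.{0}) (kappa : Ordinal.{0}) : Prop :=
  S ⊆ Set.Iio kappa ∧ ∀ C, IsClubIn C kappa → (S ∩ C).Nonempty

/-- `H` is homogeneous for the list `L` (where `L α ⊆ α` on the relevant domain):
whenever `α < β` are both in `H`, `L α = L β ∩ α`. -/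
def Homog (L : Ordinal.{0} → Set Ordinal.{0}) (H : Set Ordinal.{0}) : Prop :=
  ∀ alpha ∈ H, ∀ beta ∈ H, alpha < beta → L alpha = L beta ∩ Set.Iio alpha

/-- `S ⊆ κ` is a subtle subset of `κ`: for every `S`-list `L` (i.e. `L α ⊆ α` for
`α ∈ S`) and every club `C ⊆ κ` there are `α < β` in `S ∩ C` with `L α = L β ∩ α`. -/
def IsSubtleIn (S : Set Ordinal.{0}) (kappa : Ordinal.{0}) : Prop :=
  S ⊆ Set.Iio kappa ∧
  ∀ L : Ordinal.{0} → Set Ordinal.{0}, (∀ alpha ∈ S, L alpha ⊆ Set.Iio alpha) →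
    ∀ C, IsClubIn C kappa →
      ∃ alpha ∈ S ∩ C, ∃ beta ∈ S ∩ C, alpha < beta ∧ L alpha = L beta ∩ Set.Iio alpha

/-- Second-order formulas over a structure `(M, ∈, A)` where `M` is a set of sets:
de Bruijn indexed first-order variables and second-order (subset) variables,
a binary membership relation, and a unary predicate for `A`. -/
inductive SOForm : Type where
  | mem : ℕ → ℕ → SOForm
  | app : ℕ → ℕ → SOForm
  | inA : ℕ → SOForm
  | not : SOForm → SOForm
  | and : SOForm → SOForm → SOForm
  | fall : SOForm → SOForm
  | sall : SOForm → SOForm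

/-- Prepend a value to a valuation (de Bruijn style). -/
def consVal {alpha : Type 1} (x : alpha) (v : ℕ → alpha) : ℕ → alpha
  | 0 => x
  | n + 1 => v n

/-- Satisfaction of a second-order formula in the structure `(M, ∈, A)`,
relative to first- and second-order valuations; first-order quantifiers range
over `M` and second-order quantifiers range over subsets of `M`. -/
def SOSat (M A : Set ZFSet.{0}) : SOForm → (ℕ → ZFSet.{0}) → (ℕ → Set ZFSet.{0}) → Prop
  | .mem i j, v, _ => v i ∈ v j
  | .app i j, v, w => v j ∈ w i
  | .inA i, v, _ => v i ∈ A
  | .not phi, v, w => ¬ SOSat M A phi v w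
  | .and phi psi, v, w => SOSat M A phi v w ∧ SOSat M A psi v w
  | .fall phi, v, w => ∀ x ∈ M, SOSat M A phi (consVal x v) w
  | .sall phi, v, w => ∀ P : Set ZFSet.{0}, P ⊆ M → SOSat M A phi v (consVal P w)

/-- A formula is first-order if it contains no second-order quantifier. -/
def SOForm.FO : SOForm → Prop
  | .not phi => phi.FO
  | .and phi psi => phi.FO ∧ psi.FO
  | .fall phi => phi.FO
  | .sall _ => False
  | _ => True

mutual
  /-- `IsPiForm n φ` : `φ` is a `Π¹ₙ` formula. -/
  inductive IsPiForm : ℕ → SOForm → Prop where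
    | fo {phi : SOForm} : phi.FO → IsPiForm 0 phi
    | up {n : ℕ} {phi : SOForm} : IsSigmaForm n phi → IsPiForm (n + 1) phi
    | all {n : ℕ} {phi : SOForm} : IsPiForm (n + 1) phi → IsPiForm (n + 1) (SOForm.sall phi)
  /-- `IsSigmaForm n φ` : `φ` is a `Σ¹ₙ` formula. -/
  inductive IsSigmaForm : ℕ → SOForm → Prop where
    | fo {phi : SOForm} : phi.FO → IsSigmaForm 0 phi
    | up {n : ℕ} {phi : SOForm} : IsPiForm n phi → IsSigmaForm (n + 1) phi
    | ex {n : ℕ} {phi : SOForm} : IsSigmaForm (n + 1) phi →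
        IsSigmaForm (n + 1) (SOForm.not (SOForm.sall (SOForm.not phi)))
end

/-- Satisfaction of a sentence: satisfaction under the default valuations. -/
def SOSatS (M A : Set ZFSet.{0}) (phi : SOForm) : Prop :=
  SOSat M A phi (fun _ => ∅) (fun _ => ∅)

/-- The rank-initial segment `V_α` of the set-theoretic universe. -/
def Vrank (alpha : Ordinal.{0}) : Set ZFSet.{0} := {x | ZFSet.rank x < alpha}

/-- `X ⊆ κ` is a `Π¹ₙ`-indescribable subset of `κ` : for every `A ⊆ V_κ` and every
`Π¹ₙ` sentence `φ`, if `(V_κ, ∈, A) ⊨ φ` then `(V_ξ, ∈, A ∩ V_ξ) ⊨ φ` for some `ξ ∈ X`. -/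
def PiIndesc (n : ℕ) (X : Set Ordinal.{0}) (kappa : Ordinal.{0}) : Prop :=
  X ⊆ Set.Iio kappa ∧
  ∀ A : Set ZFSet.{0}, A ⊆ Vrank kappa → ∀ phi : SOForm, IsPiForm n phi →
    SOSatS (Vrank kappa) A phi → ∃ xi ∈ X, SOSatS (Vrank xi) (A ∩ Vrank xi) phi

open Cardinal in
/-- The cardinal `κ.card` is regular and uncountable, and `κ` is its initial ordinal. -/
theorem RegUncountable.card_facts {kappa : Ordinal.{0}} (h : RegUncountable kappa) :
    kappa.cof = kappa.card ∧ kappa.card.ord = kappa ∧ ℵ₀ < kappa.card := by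
  obtain ⟨hω, hc⟩ := h
  have hcard : kappa.cof = kappa.card := by rw [← card_ord kappa.cof, hc]
  refine ⟨hcard, hcard ▸ hc, ?_⟩
  rw [← hc, lt_ord, Ordinal.card_omega0] at hω
  rwa [← hcard]

/-- Final segments of a limit ordinal are club. -/
theorem isClubIn_Ioo {kappa lam : Ordinal.{0}} (hk : Order.IsSuccLimit kappa)
    (hlam : lam < kappa) : IsClubIn (Set.Ioo lam kappa) kappa := by
  refine ⟨fun _ h => h.2, fun a ha => ⟨Order.succ (max a lam), ⟨?_, ?_⟩, ?_⟩, ?_⟩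
  · exact Order.lt_succ_of_le (le_max_right _ _)
  · exact hk.succ_lt (max_lt ha hlam)
  · exact Order.lt_succ_of_le (le_max_left _ _)
  · intro b hb hb0 h
    obtain ⟨d, hd, -, hdb⟩ := h 0 (pos_iff_ne_zero.2 hb0)
    exact ⟨hd.1.trans hdb, hb⟩

open Cardinal in
/-- A regular uncountable cardinal carrying a subtle set is inaccessible. -/
theorem IsSubtleIn.isInaccessible {kappa : Ordinal.{0}} {S : Set Ordinal.{0}}
    (hreg : RegUncountable kappa) (hS : IsSubtleIn S kappa) : kappa.card.IsInaccessible := by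
  obtain ⟨hcof, hord, hunc⟩ := hreg.card_facts
  have hlim : Order.IsSuccLimit kappa := hord ▸ isSuccLimit_ord hunc.le
  refine ⟨hunc, by rw [hord, hcof], fun x hx => ?_⟩
  by_contra! hle
  have hlam : x.ord < kappa := by
    rw [← hord]
    exact ord_lt_ord.2 hx
  have hcard : #(Set.Iio kappa) ≤ #(Set (Set.Iio x.ord)) := by
    rw [mk_set, mk_Iio_ordinal, mk_Iio_ordinal, card_ord, ← lift_two_power, lift_le]
    exact hle
  obtain ⟨f⟩ := hcard
  let L : Ordinal.{0} → Set Ordinal.{0} := fun a =>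
    {b | ∃ (ha : a < kappa) (hb : b < x.ord), b < a ∧ (⟨b, hb⟩ : Set.Iio x.ord) ∈ f ⟨a, ha⟩}
  obtain ⟨a, ⟨-, haC⟩, b, ⟨-, hbC⟩, hab, heq⟩ :=
    hS.2 L (fun a _ c hc => hc.2.2.1) _ (isClubIn_Ioo hlim hlam)
  have hf : f ⟨a, haC.2⟩ = f ⟨b, hbC.2⟩ := by
    ext ⟨c, hc⟩
    have hmem : c ∈ L a ↔ c ∈ L b ∩ Set.Iio a := by rw [heq]
    have hca : c < a := lt_trans hc haC.1
    have h1 : c ∈ L a ↔ (⟨c, hc⟩ : Set.Iio x.ord) ∈ f ⟨a, haC.2⟩ :=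
      ⟨fun h => h.2.2.2, fun h => ⟨haC.2, hc, hca, h⟩⟩
    have h2 : c ∈ L b ∩ Set.Iio a ↔ (⟨c, hc⟩ : Set.Iio x.ord) ∈ f ⟨b, hbC.2⟩ :=
      ⟨fun h => h.1.2.2.2, fun h => ⟨⟨hbC.2, hc, hca.trans hab, h⟩, hca⟩⟩
    rw [← h1, hmem, h2]
  exact hab.ne (congrArg Subtype.val (f.injective hf))

open Cardinal in
/-- If each initial segment of a ranked type below rank `κ` has size less than `κ`, then the part
of rank below `κ` injects into `κ`, and club many ordinals are closed under this injection. -/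
theorem exists_injOn_club {T : Type 1} {kappa : Ordinal.{0}} (hreg : RegUncountable kappa)
    (r : T → Ordinal.{0}) (hr : ∀ a < kappa, #{t | r t < a} < lift.{1} kappa.card) :
    ∃ e : T → Ordinal.{0}, Set.InjOn e {t | r t < kappa} ∧
      ∃ C, IsClubIn C kappa ∧ ∀ a ∈ C, 0 < a ∧ ∀ t, r t < a → e t < a := by
  obtain ⟨hcof, hord, hunc⟩ := hreg.card_facts
  have hlim : Order.IsSuccLimit kappa := hord ▸ isSuccLimit_ord hunc.le
  have hcard : #{t | r t < kappa} ≤ #(Set.Iio kappa) := by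
    have hU : {t | r t < kappa} = ⋃ a : Set.Iio kappa, {t | r t < a} := by
      ext t
      simp only [Set.mem_ofPred_eq, Set.mem_iUnion]
      exact ⟨fun h => ⟨⟨_, hlim.succ_lt h⟩, Order.lt_succ _⟩, fun ⟨a, h⟩ => h.trans a.2⟩
    rw [hU]
    refine (mk_iUnion_le _).trans ?_
    rw [mk_Iio_ordinal]
    refine mul_le_of_le (by rw [aleph0_le_lift]; exact hunc.le) le_rfl ?_
    exact ciSup_le' fun a => (hr a a.2).le
  obtain ⟨f⟩ := hcard
  classical
  let e : T → Ordinal.{0} := fun t => if h : r t < kappa then f ⟨t, h⟩ else 0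
  have he (t : T) (h : r t < kappa) : e t = f ⟨t, h⟩ := dif_pos h
  have hek (t : T) (h : r t < kappa) : e t < kappa := by
    rw [he t h]
    exact (f ⟨t, h⟩).2
  refine ⟨e, fun s hs t ht hst => ?_,
    {a | a < kappa ∧ 0 < a ∧ ∀ t, r t < a → e t < a}, ⟨fun _ h => h.1, ?_, ?_⟩, fun _ h => h.2⟩
  · rw [he s hs, he t ht] at hst
    exact congrArg Subtype.val (f.injective (Subtype.val_injective hst))
  · let g : Ordinal.{0} → Ordinal.{0} := fun a => ⨆ t : {t | r t < a}, e t + 1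
    have hg (a : Ordinal.{0}) (ha : a < kappa) : g a < kappa := by
      refine Ordinal.lift_iSup_add_one_lt_of_lt_cof ?_ fun t => hek t (lt_trans t.2 ha)
      rw [← Ordinal.lift_cof, hcof, lift_id'.{0, 1}]
      exact hr a ha
    have heg (a : Ordinal.{0}) (ha : a < kappa) (t : T) (ht : r t < a) : e t < g a := by
      refine (Order.lt_add_one_iff.2 le_rfl).trans_le
        (le_ciSup (f := fun t : {t | r t < a} => e t + 1) ⟨kappa, ?_⟩ ⟨t, ht⟩)
      rintro _ ⟨s, rfl⟩
      exact (hlim.succ_lt (hek s (lt_trans s.2 ha))).le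
    have hℵ : ℵ₀ < kappa.cof := hcof ▸ hunc
    intro a ha
    have hlt : Ordinal.nfp g (Order.succ a) < kappa :=
      Ordinal.nfp_lt_ord hℵ hg (hlim.succ_lt ha)
    have hsucc : a < Ordinal.nfp g (Order.succ a) :=
      (Order.lt_succ a).trans_le (Ordinal.le_nfp _ _)
    refine ⟨_, ⟨hlt, pos_of_gt hsucc, fun t ht => ?_⟩, hsucc⟩
    obtain ⟨n, hn⟩ := Ordinal.lt_nfp_iff.1 ht
    refine (heg _ ((Ordinal.iterate_le_nfp _ _ n).trans_lt hlt) t hn).trans_le ?_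
    rw [← Function.iterate_succ_apply' g n]
    exact Ordinal.iterate_le_nfp _ _ _
  · intro b hb hb0 h
    refine ⟨hb, pos_iff_ne_zero.2 hb0, fun t ht => ?_⟩
    obtain ⟨d, hd, htd, hdb⟩ := h _ ht
    exact (hd.2.2 t htd).trans hdb

open Cardinal in
/-- Subtlety for lists of subsets of a ranked type whose initial segments are small. -/
theorem IsSubtleIn.exists_coherent {T : Type 1} {kappa : Ordinal.{0}} {S : Set Ordinal.{0}}
    (hreg : RegUncountable kappa) (hS : IsSubtleIn S kappa)
    (r : T → Ordinal.{0}) (hr : ∀ a < kappa, #{t | r t < a} < lift.{1} kappa.card)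
    (F : Ordinal.{0} → Set T) (hF : ∀ a ∈ S, 0 < a → F a ⊆ {t | r t < a}) :
    ∃ a ∈ S, ∃ b ∈ S, a < b ∧ F a = F b ∩ {t | r t < a} := by
  obtain ⟨e, hinj, C, hC, hCe⟩ := exists_injOn_club hreg r hr
  obtain ⟨a, ⟨haS, haC⟩, b, ⟨hbS, hbC⟩, hab, heq⟩ :=
    hS.2 (fun a => e '' F a ∩ Set.Iio a) (fun _ _ => Set.inter_subset_right) C hC
  have hak : a < kappa := hC.1 haC
  have hbk : b < kappa := hC.1 hbC
  have hFa := hF a haS (hCe a haC).1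
  have hFb := hF b hbS (hCe b hbC).1
  refine ⟨a, haS, b, hbS, hab, Set.ext fun t => ⟨fun ht => ⟨?_, hFa ht⟩, fun ⟨ht, hta⟩ => ?_⟩⟩
  · have hmem : e t ∈ e '' F a ∩ Set.Iio a := ⟨⟨t, ht, rfl⟩, (hCe a haC).2 t (hFa ht)⟩
    obtain ⟨⟨⟨s, hs, hst⟩, -⟩, -⟩ := (Set.ext_iff.1 heq _).1 hmem
    rwa [← hinj ((hFb hs).trans hbk) ((hFa ht).trans hak) hst]
  · have hmem : e t ∈ (e '' F b ∩ Set.Iio b) ∩ Set.Iio a :=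
      ⟨⟨⟨t, ht, rfl⟩, (hCe b hbC).2 t (hFb ht)⟩, (hCe a haC).2 t hta⟩
    obtain ⟨⟨s, hs, hst⟩, -⟩ := (Set.ext_iff.1 heq _).2 hmem
    rwa [← hinj ((hFa hs).trans hak) ((hFb ht).trans hbk) hst]

/-- A Gödel numbering of second-order formulas. -/
def SOForm.code : SOForm → ℕ
  | .mem i j => 7 * Nat.pair i j
  | .app i j => 7 * Nat.pair i j + 1
  | .inA i => 7 * i + 2
  | .not phi => 7 * phi.code + 3
  | .and phi psi => 7 * Nat.pair phi.code psi.code + 4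
  | .fall phi => 7 * phi.code + 5
  | .sall phi => 7 * phi.code + 6

theorem SOForm.code_injective : Function.Injective SOForm.code := by
  intro phi
  induction phi with
  | mem i j =>
    intro psi h
    cases psi <;> simp only [SOForm.code] at h <;> try omega
    rename_i k l
    obtain ⟨rfl, rfl⟩ := Nat.pair_eq_pair.1 (by omega : Nat.pair i j = Nat.pair k l)
    rfl
  | app i j =>
    intro psi h
    cases psi <;> simp only [SOForm.code] at h <;> try omega
    rename_i k l
    obtain ⟨rfl, rfl⟩ := Nat.pair_eq_pair.1 (by omega : Nat.pair i j = Nat.pair k l)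
    rfl
  | inA i =>
    intro psi h
    cases psi <;> simp only [SOForm.code] at h <;> try omega
    congr 1
    omega
  | not phi ih | fall phi ih | sall phi ih =>
    intro psi h
    cases psi <;> simp only [SOForm.code] at h <;> try omega
    congr 1
    exact ih (by omega)
  | and phi psi ih1 ih2 =>
    intro chi h
    cases chi <;> simp only [SOForm.code] at h <;> try omega
    rename_i k l
    obtain ⟨h1, h2⟩ := Nat.pair_eq_pair.1
      (by omega : Nat.pair phi.code psi.code = Nat.pair k.code l.code)
    rw [ih1 h1, ih2 h2]

instance : Countable SOForm := SOForm.code_injective.countable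

open Cardinal in
/-- Below an inaccessible cardinal, the levels `V_α` are small. -/
theorem mk_Vrank_lt {c : Cardinal.{0}} (hc : c.IsInaccessible) {a : Ordinal.{0}}
    (ha : a < c.ord) : #(Vrank a) < lift.{1} c := by
  have hV : Vrank a = {x | x ∈ ZFSet.vonNeumann a} := by
    ext x
    exact ZFSet.mem_vonNeumann.symm
  have hmk : #(Vrank a) = lift.{1} (preBeth a) := by
    rw [hV, ← ZFSet.card_vonNeumann]
    exact ZFSet.cardinalMk_coe_sort
  rw [hmk, lift_lt, ← hc.preBeth_ord]
  exact preBeth_strictMono ha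

/-- The rank of a set, an ordinal or a formula; formulas have rank zero. -/
noncomputable def codeRank : ZFSet.{0} ⊕ Ordinal.{0} ⊕ SOForm → Ordinal.{0}
  | .inl x => x.rank
  | .inr (.inl a) => a
  | .inr (.inr _) => 0

open Cardinal in
theorem mk_codeRank_lt {c : Cardinal.{0}} (hc : c.IsInaccessible) {a : Ordinal.{0}}
    (ha : a < c.ord) : #{t | codeRank t < a} < lift.{1} c := by
  have hsub : {t | codeRank t < a} ⊆ Sum.inl '' Vrank a ∪
      ((fun b => Sum.inr (Sum.inl b)) '' Set.Iio a ∪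
        Set.range fun phi => Sum.inr (Sum.inr phi)) := by
    rintro (x | b | phi) ht
    · exact .inl ⟨x, ht, rfl⟩
    · exact .inr (.inl ⟨b, ht, rfl⟩)
    · exact .inr (.inr ⟨phi, rfl⟩)
  have hinf : ℵ₀ < lift.{1} c := by simpa using hc.aleph0_lt
  refine (mk_le_mk_of_subset hsub).trans_lt ((mk_union_le _ _).trans_lt
    (add_lt_of_lt hinf.le (mk_image_le.trans_lt (mk_Vrank_lt hc ha))
      ((mk_union_le _ _).trans_lt (add_lt_of_lt hinf.le (mk_image_le.trans_lt ?_) ?_))))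
  · rw [mk_Iio_ordinal, lift_lt]
    exact lt_ord.1 ha
  · exact (Set.countable_range _).le_aleph0.trans_lt hinf

/-- Baumgartner. If `S ⊆ κ` is subtle and `L` is an `S`-list, then
`S ∖ A` is not subtle, where `A` is the set of `α ∈ S` admitting an `X ⊆ S ∩ α` which is
`Π¹ₙ`-indescribable in `α` for all `n < ω` and homogeneous for `L`. -/
theorem subtle_minus_indescribable_homogeneous (kappa : Ordinal.{0})
    (hreg : RegUncountable kappa)
    (S : Set Ordinal.{0}) (hS : IsSubtleIn S kappa)
    (L : Ordinal.{0} → Set Ordinal.{0}) (hL : ∀ alpha ∈ S, L alpha ⊆ Set.Iio alpha) :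
    ¬ IsSubtleIn
      (S \ {alpha | alpha ∈ S ∧ ∃ X, X ⊆ S ∩ Set.Iio alpha ∧
        (∀ n : ℕ, PiIndesc n X alpha) ∧ Homog L X}) kappa := by
  intro hB
  set B := S \ {alpha | alpha ∈ S ∧ ∃ X, X ⊆ S ∩ Set.Iio alpha ∧
    (∀ n : ℕ, PiIndesc n X alpha) ∧ Homog L X}
  have hinac := hS.isInaccessible hreg
  have hord := hreg.card_facts.2.1
  have hwit : ∀ a ∈ B, ∃ (A : Set ZFSet.{0}) (phi : SOForm), A ⊆ Vrank a ∧
      SOSatS (Vrank a) A phi ∧ ∀ xi ∈ S, xi < a → L xi = L a ∩ Set.Iio xi →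
        ¬ SOSatS (Vrank xi) (A ∩ Vrank xi) phi := by
    rintro a ⟨haS, hna⟩
    let X : Set Ordinal.{0} := {xi | xi ∈ S ∧ xi < a ∧ L xi = L a ∩ Set.Iio xi}
    have hhom : Homog L X := by
      rintro x ⟨-, -, hx⟩ y ⟨-, -, hy⟩ hxy
      rw [hx, hy, Set.inter_assoc, Set.Iio_inter_Iio, min_eq_right hxy.le]
    have hnot : ¬ ∀ n : ℕ, PiIndesc n X a := fun h =>
      hna ⟨haS, X, fun x hx => ⟨hx.1, hx.2.1⟩, h, hhom⟩
    obtain ⟨n, hn⟩ := not_forall.1 hnot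
    by_contra! hcon
    refine hn ⟨fun x hx => hx.2.1, fun A hA phi _ hsat => ?_⟩
    obtain ⟨xi, h1, h2, h3, h4⟩ := hcon A phi hA hsat
    exact ⟨xi, ⟨h1, h2, h3⟩, h4⟩
  have : Nonempty SOForm := ⟨.inA 0⟩
  choose! A phi hA hsat hno using hwit
  let F : Ordinal.{0} → Set (ZFSet.{0} ⊕ Ordinal.{0} ⊕ SOForm) := fun a =>
    {t | Sum.elim (· ∈ A a) (Sum.elim (· ∈ L a) (· = phi a)) t}
  obtain ⟨a, haB, b, hbB, hab, heq⟩ := hB.exists_coherent hreg codeRank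
    (fun a ha => mk_codeRank_lt hinac (hord.symm ▸ ha)) F (by
      rintro a ha h0 (x | c | psi) ht
      · exact hA a ha ht
      · exact hL a ha.1 ht
      · exact h0)
  have hAeq : A a = A b ∩ Vrank a := Set.ext fun x => Set.ext_iff.1 heq (.inl x)
  have hLeq : L a = L b ∩ Set.Iio a := Set.ext fun c => Set.ext_iff.1 heq (.inr (.inl c))
  have hphi : phi a = phi b := ((Set.ext_iff.1 heq (.inr (.inr (phi a)))).1 rfl).1
  refine hno b hbB a haB.1 hab hLeq ?_
  rw [← hAeq, ← hphi]
  exact hsat a haB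

end LCI
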